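/- arXiv:math/0105195 — 2 statements merged into one kernel-verified Lean document; each statement's English description precedes it below -/
import Mathlib

section
/- For every n ∈ ℕ and every a ∈ A one has α(ℰ_n(ℒ(a)* ℒ(a))) ≤ ℰ_{n+1}(a* a) in the partial order of positive elements of A (so that ℒ extends to a contraction from the Hilbert module determined by the inner product ⟨a,b⟩ = ℰ_{n+1}(a*b) to the one determined by ⟨a,b⟩ = ℰ_n(a*b)). -/
/-- An injective star homomorphism of unital C⋆-algebras reflects positivity of elements. -/
theorem StarAlgHom.nonneg_of_map_nonneg {A B : Type*} [CStarAlgebra A] [PartialOrder A]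
    [StarOrderedRing A] [CStarAlgebra B] [PartialOrder B] [StarOrderedRing B]
    (φ : A →⋆ₐ[ℂ] B) (hφ : Function.Injective φ) {x : A} (hx : 0 ≤ φ x) : 0 ≤ x := by
  have hsa : IsSelfAdjoint x := hφ <| by
    rw [map_star]
    exact (IsSelfAdjoint.of_nonneg hx).star_eq
  rw [StarOrderedRing.nonneg_iff_spectrum_nonneg (R := ℝ) x hsa, ← hsa.map_spectrum_real φ hφ]
  exact fun r hr ↦ spectrum_nonneg_of_nonneg hx hr

/-- The Kadison–Schwarz inequality for a positive linear map that is a bimodule map over the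
range of a star homomorphism `α` containing its own range, in terms of the associated
transfer operator `L`. -/
theorem star_mul_self_le_of_comp_eq_condExp {A : Type*} [CStarAlgebra A] [PartialOrder A]
    [StarOrderedRing A] (α : A →⋆ₐ[ℂ] A) (hα : Function.Injective α)
    (E : A →ₗ[ℂ] A) (hEpos : ∀ x : A, 0 ≤ x → 0 ≤ E x) (hEfix : ∀ a : A, E (α a) = α a)
    (hEbimod : ∀ a b x : A, E (α a * x * α b) = α a * E x * α b)
    (L : A →ₗ[ℂ] A) (hL : ∀ a : A, α (L a) = E a) (a : A) :
    star (L a) * L a ≤ L (star a * a) := by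
  have hEstar : E (star a) = star (E a) := map_star (PositiveLinearMap.mk₀ E hEpos) a
  have hleft : E (α (star (L a)) * a) = star (E a) * E a := by
    simpa [map_star, hL] using hEbimod (star (L a)) 1 a
  have hright : E (star a * α (L a)) = star (E a) * E a := by
    simpa [hL, hEstar] using hEbimod 1 (L a) (star a)
  have hmid : E (α (star (L a)) * α (L a)) = star (E a) * E a := by
    simpa [map_star, hL] using hEfix (star (L a) * L a)
  have hexpand : star (a - α (L a)) * (a - α (L a)) =
      star a * a - star a * α (L a) - α (star (L a)) * a + α (star (L a)) * α (L a) := by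
    rw [star_sub, map_star]
    noncomm_ring
  have hpos := hEpos _ (star_mul_self_nonneg (a - α (L a)))
  rw [hexpand, map_add, map_sub, map_sub, hleft, hright, hmid, sub_add_cancel] at hpos
  rw [← sub_nonneg]
  refine StarAlgHom.nonneg_of_map_nonneg α hα ?_
  rwa [map_sub, map_mul α, map_star α, hL, hL]


/-- Proposition 4.3 (key inequality): `α (ℰ n (ℒ(a)* ℒ(a))) ≤ ℰ (n+1) (a* a)`, so that `ℒ`
induces a contraction of Hilbert modules. -/
theorem transfer_operator_contraction {A : Type*}
    [NormedRing A] [StarRing A] [CStarRing A] [NormedAlgebra ℂ A] [CompleteSpace A]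
    [StarModule ℂ A] [PartialOrder A] [StarOrderedRing A]
    (α : A →⋆ₐ[ℂ] A) (hα : Function.Injective α)
    (E : A →ₗ[ℂ] A) (hEpos : ∀ x : A, 0 ≤ x → 0 ≤ E x)
    (hErange : ∀ x : A, ∃ y : A, α y = E x)
    (hEfix : ∀ a : A, E (α a) = α a)
    (hEbimod : ∀ a b x : A, E (α a * x * α b) = α a * E x * α b)
    (L : A →ₗ[ℂ] A) (hL : ∀ a : A, α (L a) = E a)
    (𝓔 : ℕ → A → A) (h𝓔0 : 𝓔 0 = id)
    (h𝓔rec : ∀ (k : ℕ) (x : A), 𝓔 (k + 1) x = α (𝓔 k (L x)))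
    (n : ℕ) (a : A) :
    α (𝓔 n (star (L a) * L a)) ≤ 𝓔 (n + 1) (star a * a) := by
  let _ : CStarAlgebra A := {}
  have hLmono : Monotone L := fun x y hxy ↦ by
    rw [← sub_nonneg, ← map_sub]
    refine StarAlgHom.nonneg_of_map_nonneg α hα ?_
    rw [hL]
    exact hEpos _ (sub_nonneg.2 hxy)
  have h𝓔mono : ∀ k, Monotone (𝓔 k) := fun k ↦ by
    induction k with
    | zero => exact h𝓔0 ▸ monotone_id
    | succ k ih =>
      intro x y hxy
      rw [h𝓔rec, h𝓔rec]
      exact OrderHomClass.mono α (ih (hLmono hxy))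
  rw [h𝓔rec]
  exact OrderHomClass.mono α <| h𝓔mono n <|
    star_mul_self_le_of_comp_eq_condExp α hα E hEpos hEfix hEbimod L hL a
end

section
/- Let Λ be an invertible element of the center of A and let φ : A → ℂ be a continuous linear functional which is tracial (φ(ab) = φ(ba) for all a, b ∈ A) and satisfies φ(a) = φ(ℒ(Λ·a)) for all a ∈ A. Then for all u, v ∈ A and all n, m ∈ ℕ one has φ(α^n(ℒ^m(u)) · v) = φ(u · Λ^{-[m]} · α^m(ℒ^n(Λ^[n] · v))), where Λ^{-[m]} denotes (Λ⁻¹)^[m]. -/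
/-- `bpow f a n` is the element `a^[n] = a · f(a) · f²(a) ⋯ f^{n-1}(a)`, with `a^[0] = 1`. -/
def bpow {A : Type*} [Monoid A] (f : A → A) (a : A) : ℕ → A
  | 0 => 1
  | n + 1 => bpow f a n * f^[n] a

theorem iterate_transfer_mul {A : Type*} [Mul A] {f L : A → A}
    (hL : ∀ a b, L (f a * b) = a * L b) (n : ℕ) (a b : A) :
    L^[n] (f^[n] a * b) = a * L^[n] b := by
  induction n generalizing b with
  | zero => rfl
  | succ n ih =>
    rw [Function.iterate_succ_apply, Function.iterate_succ_apply', hL, ih,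
      Function.iterate_succ_apply]

section IteratedTwistedProduct

variable {A F : Type*} [Monoid A] [FunLike F A A] [MonoidHomClass F A A] (f : F)

theorem commute_bpow_iterate {a : A} (ha : ∀ x, Commute a x) (n : ℕ) (x : A) :
    Commute (bpow f a n) (f^[n] x) := by
  induction n generalizing x with
  | zero => exact Commute.one_left x
  | succ n ih =>
    rw [Function.iterate_succ_apply]
    refine (ih (f x)).mul_left ?_
    rw [commute_iff_eq, ← iterate_map_mul, (ha (f x)).eq, iterate_map_mul]

theorem bpow_mul_bpow_eq_one {a b : A} (hb : ∀ x, Commute b x) (hab : a * b = 1) (n : ℕ) :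
    bpow f a n * bpow f b n = 1 := by
  induction n with
  | zero => exact one_mul 1
  | succ n ih =>
    have hn : f^[n] a * f^[n] b = 1 := by
      rw [← iterate_map_mul, hab, iterate_map_one]
    change bpow f a n * f^[n] a * (bpow f b n * f^[n] b) = 1
    rw [mul_assoc, ← mul_assoc (f^[n] a), ← (commute_bpow_iterate f hb n a).eq,
      mul_assoc (bpow f b n), hn, mul_one, ih]

theorem apply_iterate_transfer_bpow_mul {R : Type*} {L : A → A}
    (hL : ∀ a b, L (f a * b) = a * L b) {a : A} (ha : ∀ x, Commute a x) {φ : A → R}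
    (hφ : ∀ x, φ x = φ (L (a * x))) (n : ℕ) (x : A) :
    φ (L^[n] (bpow f a n * x)) = φ x := by
  induction n with
  | zero => exact congrArg φ (one_mul x)
  | succ n ih =>
    change φ (L^[n + 1] (bpow f a n * f^[n] a * x)) = φ x
    rw [Function.iterate_succ_apply', (commute_bpow_iterate f ha n a).eq, mul_assoc,
      iterate_transfer_mul hL, ← hφ, ih]

end IteratedTwistedProduct

/-- The key identity in the proof of Proposition 9.2: if `φ` is a continuous tracial
functional with `φ(a) = φ(ℒ(Λ a))` for a central invertible `Λ`, then
`φ(α^n(ℒ^m(u)) v) = φ(u Λ^{-[m]} α^m(ℒ^n(Λ^[n] v)))`. -/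
theorem kms_functional_identity {A : Type*}
    [NormedRing A] [StarRing A] [CStarRing A] [NormedAlgebra ℂ A] [CompleteSpace A]
    [StarModule ℂ A] [PartialOrder A] [StarOrderedRing A]
    (α : A →⋆ₐ[ℂ] A) (hα : Function.Injective α)
    (E : A →ₗ[ℂ] A) (hEpos : ∀ x : A, 0 ≤ x → 0 ≤ E x)
    (hErange : ∀ x : A, ∃ y : A, α y = E x)
    (hEfix : ∀ a : A, E (α a) = α a)
    (hEbimod : ∀ a b x : A, E (α a * x * α b) = α a * E x * α b)
    (L : A →ₗ[ℂ] A) (hL : ∀ a : A, α (L a) = E a)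
    (Λ Λ' : A) (hΛc : Λ ∈ Set.center A)
    (hinv1 : Λ * Λ' = 1) (hinv2 : Λ' * Λ = 1)
    (φ : A →L[ℂ] ℂ) (htr : ∀ a b : A, φ (a * b) = φ (b * a))
    (hφ : ∀ a : A, φ a = φ (L (Λ * a)))
    (u v : A) (n m : ℕ) :
    φ ((⇑α)^[n] ((⇑L)^[m] u) * v)
      = φ (u * bpow ⇑α Λ' m * (⇑α)^[m] ((⇑L)^[n] (bpow ⇑α Λ n * v))) := by
  have hL' (a b : A) : L (α a * b) = a * L b := by
    apply hα
    have h := hEbimod a 1 b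
    rw [map_one, mul_one, mul_one] at h
    rw [hL, h, map_mul α, hL]
  have hΛ (x : A) : Commute Λ x := hΛc.comm x
  have hΛ' (x : A) : Commute Λ' x :=
    (hΛ x).units_inv_left (u := ⟨Λ, Λ', hinv1, hinv2⟩)
  have hcomm : bpow α Λ n * ((⇑α)^[n] ((⇑L)^[m] u) * v)
      = (⇑α)^[n] ((⇑L)^[m] u) * (bpow α Λ n * v) := by
    rw [← mul_assoc, (commute_bpow_iterate α hΛ n _).eq, mul_assoc]
  set y := (⇑L)^[n] (bpow α Λ n * v)
  have hleft : φ ((⇑α)^[n] ((⇑L)^[m] u) * v) = φ ((⇑L)^[m] u * y) := by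
    rw [← apply_iterate_transfer_bpow_mul α hL' hΛ hφ n]
    exact congrArg φ ((congrArg _ hcomm).trans (iterate_transfer_mul hL' n _ _))
  have hright : (⇑L)^[m] (bpow α Λ m * (bpow α Λ' m * ((⇑α)^[m] y * u)))
      = y * (⇑L)^[m] u := by
    rw [← mul_assoc, bpow_mul_bpow_eq_one α hΛ' hinv1 m, one_mul]
    exact iterate_transfer_mul hL' m y u
  rw [hleft, htr, ← hright, mul_assoc u, htr u, mul_assoc]
  exact apply_iterate_transfer_bpow_mul α hL' hΛ hφ m _
end
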